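/- arXiv:1405.1100 — 3 statements merged into one kernel-verified Lean document; each statement's English description precedes it below -/
import Mathlib

section
/- Let A be a C*-algebra and I a closed two-sided ideal of A. If both I (as a C*-algebra) and the quotient C*-algebra A/I have the countable chain condition, then A has the countable chain condition. -/
/-- A C*-algebra has the countable chain condition (CCC) if every family of pairwise
orthogonal nonzero closed two-sided ideals is countable; two closed two-sided ideals are
orthogonal if their intersection is the zero ideal.  (Only the ring and topological
structure of the algebra are needed to state this.) -/
def CStarCCC (A : Type*) [NonUnitalNonAssocRing A] [TopologicalSpace A] : Prop :=
  ∀ 𝒮 : Set (TwoSidedIdeal A), (∀ I ∈ 𝒮, IsClosed (I : Set A)) →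
    (∀ I ∈ 𝒮, I ≠ ⊥) → (𝒮.Pairwise fun I J => I ⊓ J = ⊥) → 𝒮.Countable

namespace TwoSidedIdeal

section ApproximateUnit

variable {A : Type*} [NonUnitalCStarAlgebra A]

lemma continuous_div_sq_add {δ : ℝ} (hδ : 0 < δ) {f : ℝ → ℝ} (hf : Continuous f) :
    Continuous fun t : ℝ ↦ f t / (t ^ 2 + δ) := by
  fun_prop (disch := intro x; positivity)

/-- Approximate units of a two-sided ideal `J` of a C⋆-algebra, at a single element of `J`. -/
lemma exists_approximateUnit (J : TwoSidedIdeal A) {a : A} (ha : a ∈ J) {ε : ℝ} (hε : 0 < ε) :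
    ∃ e ∈ J, IsSelfAdjoint e ∧ ‖a - a * e‖ ≤ ε ∧ ∀ x : A, ‖x - x * e‖ ≤ ‖x‖ := by
  set δ : ℝ := ε ^ 4 with hδ_def
  have hδ : 0 < δ := by positivity
  set h : A := star a * a with hh
  have hsa : IsSelfAdjoint h := .star_mul_self a
  set f : ℝ → ℝ := fun t ↦ t ^ 2 / (t ^ 2 + δ)
  have hfc : Continuous f := continuous_div_sq_add hδ (by fun_prop)
  have hgc : Continuous fun t : ℝ ↦ t / (t ^ 2 + δ) := continuous_div_sq_add hδ (by fun_prop)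
  have hpos (t : ℝ) : 0 < t ^ 2 + δ := by positivity
  have hmul : cfcₙ f h = h * cfcₙ (fun t : ℝ ↦ t / (t ^ 2 + δ)) h := by
    conv_rhs => rw [← cfcₙ_id' ℝ h, cfcₙ_id' ℝ h]
    nth_rw 2 [← cfcₙ_id' ℝ h]
    rw [← cfcₙ_mul _ _ h (by fun_prop) (by simp) hgc.continuousOn (by simp)]
    congr 1
    ext t
    simp only [f]
    ring
  have hcoe : ((cfcₙ f h : A) : Unitization ℂ A) = cfc f (h : Unitization ℂ A) :=
    Unitization.real_cfcₙ_eq_cfc_inr h f (by simp [f])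
  have hone : 1 - cfc f (h : Unitization ℂ A) = cfc (fun t ↦ 1 - f t) (h : Unitization ℂ A) := by
    rw [cfc_sub _ _ _ (by fun_prop) (by fun_prop), cfc_const_one ℝ _]
  have hbound (t : ℝ) : 0 ≤ 1 - f t ∧ 1 - f t ≤ 1 := by
    have : 1 - f t = δ / (t ^ 2 + δ) := by
      have := (hpos t).ne'
      simp only [f]
      field_simp
      ring
    rw [this]
    exact ⟨by positivity, by rw [div_le_one (hpos t)]; nlinarith [sq_nonneg t]⟩
  have hnorm : ‖1 - cfc f (h : Unitization ℂ A)‖ ≤ 1 := by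
    rw [hone]
    refine norm_cfc_le zero_le_one fun t _ ↦ ?_
    rw [Real.norm_of_nonneg (hbound t).1]
    exact (hbound t).2
  have hinr (x : A) : ‖x - x * cfcₙ f h‖ =
      ‖(x : Unitization ℂ A) * (1 - cfc f (h : Unitization ℂ A))‖ := by
    rw [← Unitization.norm_inr (𝕜 := ℂ), Unitization.inr_sub, Unitization.inr_mul, hcoe, mul_sub,
      mul_one]
  refine ⟨cfcₙ f h, ?_, cfcₙ_predicate f h, ?_, fun x ↦ ?_⟩
  · rw [hmul]
    exact J.mul_mem_right _ _ (J.mul_mem_left _ _ ha)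
  · rw [hinr]
    refine abs_le_of_sq_le_sq' ?_ hε.le |>.2
    rw [sq, ← CStarRing.norm_star_mul_self, star_mul, hone,
      (cfc_predicate (R := ℝ) (p := IsSelfAdjoint) _ (h : Unitization ℂ A)).star_eq, mul_assoc,
      ← mul_assoc (star _), ← Unitization.inr_star, ← Unitization.inr_mul, ← hh]
    nth_rw 2 [← cfc_id' ℝ (h : Unitization ℂ A)]
    rw [← cfc_mul _ _ _ (by fun_prop) (by fun_prop), ← cfc_mul _ _ _ (by fun_prop) (by fun_prop)]
    refine norm_cfc_le (by positivity) fun t _ ↦ ?_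
    have h1 : ‖(1 - f t) * (t * (1 - f t))‖ = |t| * (1 - f t) * (1 - f t) := by
      rw [norm_mul, norm_mul, Real.norm_of_nonneg (hbound t).1, Real.norm_eq_abs]
      ring
    have h2 : |t| * (1 - f t) ≤ ε ^ 2 := by
      have : |t| * (1 - f t) = |t| * δ / (|t| ^ 2 + δ) := by
        have := (hpos t).ne'
        simp only [f, sq_abs]
        field_simp
        ring
      have key : |t| * ε ^ 2 ≤ |t| ^ 2 + ε ^ 4 := by
        nlinarith [sq_nonneg (|t| - ε ^ 2), mul_nonneg (abs_nonneg t) (sq_nonneg ε)]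
      rw [this, div_le_iff₀ (by positivity), hδ_def]
      calc |t| * ε ^ 4 = ε ^ 2 * (|t| * ε ^ 2) := by ring
        _ ≤ ε ^ 2 * (|t| ^ 2 + ε ^ 4) := by gcongr
    rw [h1]
    exact (mul_le_of_le_one_right (mul_nonneg (abs_nonneg t) (hbound t).1) (hbound t).2).trans h2
  · rw [hinr]
    exact (norm_mul_le _ _).trans ((mul_le_of_le_one_right (norm_nonneg _) hnorm).trans_eq
      (Unitization.norm_inr x))

variable {J : TwoSidedIdeal A}

lemma mem_of_forall_norm_sub_le (hJ : IsClosed (J : Set A)) {x : A}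
    (h : ∀ ε > 0, ∃ y ∈ J, ‖x - y‖ ≤ ε) : x ∈ J := by
  refine hJ.closure_subset (Metric.mem_closure_iff.2 fun ε hε ↦ ?_)
  obtain ⟨y, hy, hxy⟩ := h (ε / 2) (by positivity)
  exact ⟨y, hy, by rw [dist_eq_norm]; linarith⟩

lemma star_mem_of_isClosed (hJ : IsClosed (J : Set A)) {a : A} (ha : a ∈ J) : star a ∈ J := by
  refine mem_of_forall_norm_sub_le hJ fun ε hε ↦ ?_
  obtain ⟨e, he, hsa, hae, -⟩ := J.exists_approximateUnit ha hε
  refine ⟨e * star a, J.mul_mem_right _ _ he, ?_⟩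
  rwa [← norm_star, star_sub, star_mul, star_star, hsa.star_eq]

lemma smul_mem_of_isClosed (hJ : IsClosed (J : Set A)) (c : ℂ) {a : A} (ha : a ∈ J) :
    c • a ∈ J := by
  refine mem_of_forall_norm_sub_le hJ fun ε hε ↦ ?_
  obtain ⟨e, he, -, hae, -⟩ :=
    J.exists_approximateUnit ha (ε := ε / (‖c‖ + 1)) (by positivity)
  refine ⟨a * (c • e), J.mul_mem_right _ _ ha, ?_⟩
  rw [mul_smul_comm, ← smul_sub, norm_smul]
  calc ‖c‖ * ‖a - a * e‖ ≤ (‖c‖ + 1) * (ε / (‖c‖ + 1)) := by gcongr; linarith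
    _ = ε := by field_simp

/-- A closed two-sided ideal of a C⋆-algebra, as a complex subspace. -/
def closedSubmodule (J : TwoSidedIdeal A) (hJ : IsClosed (J : Set A)) : Submodule ℂ A where
  carrier := J
  add_mem' := J.add_mem
  zero_mem' := J.zero_mem
  smul_mem' c _ ha := smul_mem_of_isClosed hJ c ha

end ApproximateUnit

section Quotient

variable {A : Type*} [NonUnitalCStarAlgebra A] (J : TwoSidedIdeal A) (hJ : IsClosed (J : Set A))

/-- The quotient of a C⋆-algebra by a closed two-sided ideal. -/
abbrev CStarQuotient := A ⧸ J.closedSubmodule hJ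

namespace CStarQuotient

variable {J hJ}

/-- The quotient map. -/
abbrev mk (a : A) : J.CStarQuotient hJ := Submodule.Quotient.mk a

lemma mk_eq_mk_iff {a b : A} : (mk a : J.CStarQuotient hJ) = mk b ↔ a - b ∈ J :=
  Submodule.Quotient.eq _

noncomputable instance : Mul (J.CStarQuotient hJ) where
  mul := Quotient.map₂ (· * ·) fun a a' ha b b' hb ↦ by
    rw [← Quotient.eq_iff_equiv] at ha hb ⊢
    have ha' : a - a' ∈ J := mk_eq_mk_iff.1 ha
    have hb' : b - b' ∈ J := mk_eq_mk_iff.1 hb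
    refine mk_eq_mk_iff.2 ?_
    rw [show a * b - a' * b' = (a - a') * b + a' * (b - b') by noncomm_ring]
    exact J.add_mem (J.mul_mem_right _ _ ha') (J.mul_mem_left _ _ hb')

noncomputable instance : Star (J.CStarQuotient hJ) where
  star := Quotient.map star fun a b hab ↦ by
    rw [← Quotient.eq_iff_equiv] at hab ⊢
    refine mk_eq_mk_iff.2 ?_
    rw [← star_sub]
    exact star_mem_of_isClosed hJ (mk_eq_mk_iff.1 hab)

lemma mk_mul (a b : A) : (mk (a * b) : J.CStarQuotient hJ) = mk a * mk b := rfl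

lemma mk_star (a : A) : (mk (star a) : J.CStarQuotient hJ) = star (mk a) := rfl

lemma exists_norm_lt (x : J.CStarQuotient hJ) {ε : ℝ} (hε : 0 < ε) :
    ∃ a : A, mk a = x ∧ ‖a‖ < ‖x‖ + ε :=
  Submodule.Quotient.norm_mk_lt x hε

lemma norm_mk_le (a : A) : ‖(mk a : J.CStarQuotient hJ)‖ ≤ ‖a‖ :=
  Submodule.Quotient.norm_mk_le _ a

lemma norm_mul_self_le_norm_star_mul_self (x : J.CStarQuotient hJ) :
    ‖x‖ * ‖x‖ ≤ ‖star x * x‖ := by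
  obtain ⟨a, rfl⟩ := Submodule.Quotient.mk_surjective _ x
  refine le_of_forall_pos_le_add fun ε hε ↦ ?_
  obtain ⟨m, hm, hmlt⟩ := exists_norm_lt (star (mk a) * mk a : J.CStarQuotient hJ) (half_pos hε)
  obtain ⟨e, he, hsa, hie, hcontr⟩ :=
    J.exists_approximateUnit (mk_eq_mk_iff.1 (hm.trans (mk_mul _ _).symm)) (half_pos hε)
  have hmk : (mk a : J.CStarQuotient hJ) = mk (a - a * e) :=
    mk_eq_mk_iff.2 (by simpa using J.mul_mem_left _ _ he)
  have hcontr' (y : A) : ‖y - e * y‖ ≤ ‖y‖ := by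
    rw [← norm_star, ← norm_star y, star_sub, star_mul, hsa.star_eq]
    exact hcontr _
  set i := m - star a * a with hi
  have key : star (a - a * e) * (a - a * e) =
      ((m - m * e) - (i - i * e)) - e * ((m - m * e) - (i - i * e)) := by
    rw [star_sub, star_mul, hsa.star_eq, hi]
    noncomm_ring
  calc ‖(mk a : J.CStarQuotient hJ)‖ * ‖(mk a : J.CStarQuotient hJ)‖
      ≤ ‖a - a * e‖ * ‖a - a * e‖ := by
        rw [hmk]
        gcongr <;> exact norm_mk_le _
    _ = ‖star (a - a * e) * (a - a * e)‖ := CStarRing.norm_star_mul_self.symm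
    _ ≤ ‖(m - m * e) - (i - i * e)‖ := by rw [key]; exact hcontr' _
    _ ≤ ‖m‖ + ε / 2 := (norm_sub_le _ _).trans (add_le_add (hcontr m) hie)
    _ ≤ ‖star (mk a) * (mk a : J.CStarQuotient hJ)‖ + ε := by linarith

noncomputable instance : NonUnitalRing (J.CStarQuotient hJ) where
  left_distrib := by
    rintro ⟨a⟩ ⟨b⟩ ⟨c⟩
    exact congr_arg mk (mul_add a b c)
  right_distrib := by
    rintro ⟨a⟩ ⟨b⟩ ⟨c⟩
    exact congr_arg mk (add_mul a b c)
  zero_mul := by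
    rintro ⟨a⟩
    exact congr_arg mk (zero_mul a)
  mul_zero := by
    rintro ⟨a⟩
    exact congr_arg mk (mul_zero a)
  mul_assoc := by
    rintro ⟨a⟩ ⟨b⟩ ⟨c⟩
    exact congr_arg mk (mul_assoc a b c)

lemma norm_mul_le_norm_mul_norm (x y : J.CStarQuotient hJ) : ‖x * y‖ ≤ ‖x‖ * ‖y‖ := by
  have hlim : Filter.Tendsto (fun ε : ℝ ↦ (‖x‖ + ε) * (‖y‖ + ε)) (nhdsWithin 0 (Set.Ioi 0))
      (nhds (‖x‖ * ‖y‖)) := by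
    have : Continuous fun ε : ℝ ↦ (‖x‖ + ε) * (‖y‖ + ε) := by fun_prop
    simpa using (this.tendsto 0).mono_left nhdsWithin_le_nhds
  refine ge_of_tendsto hlim (eventually_mem_nhdsWithin.mono fun ε hε ↦ ?_)
  obtain ⟨a, rfl, ha⟩ := exists_norm_lt x hε
  obtain ⟨b, rfl, hb⟩ := exists_norm_lt y hε
  rw [← mk_mul]
  exact (norm_mk_le _).trans ((norm_mul_le a b).trans
    (mul_le_mul ha.le hb.le (norm_nonneg _) ((norm_nonneg _).trans ha.le)))

noncomputable instance : NormedAddCommGroup (J.CStarQuotient hJ) :=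
  Submodule.Quotient.normedAddCommGroup _ (hS := hJ)

noncomputable instance : NonUnitalCStarAlgebra (J.CStarQuotient hJ) where
  __ := (inferInstance : NonUnitalRing (J.CStarQuotient hJ))
  __ := (inferInstance : NormedAddCommGroup (J.CStarQuotient hJ))
  __ := (inferInstance : Module ℂ (J.CStarQuotient hJ))
  complete := (Submodule.Quotient.completeSpace (J.closedSubmodule hJ)).complete
  norm_mul_le := norm_mul_le_norm_mul_norm
  star_involutive := by
    rintro ⟨a⟩
    exact congr_arg mk (star_star a)
  star_mul := by
    rintro ⟨a⟩ ⟨b⟩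
    exact congr_arg mk (star_mul a b)
  star_add := by
    rintro ⟨a⟩ ⟨b⟩
    exact congr_arg mk (star_add a b)
  norm_mul_self_le := norm_mul_self_le_norm_star_mul_self
  norm_smul_le := norm_smul_le
  smul_assoc := by
    rintro c ⟨a⟩ ⟨b⟩
    exact congr_arg mk (smul_mul_assoc c a b)
  smul_comm := by
    rintro c ⟨a⟩ ⟨b⟩
    exact congr_arg mk (mul_smul_comm c a b).symm
  star_smul := by
    rintro c ⟨a⟩
    exact congr_arg mk (star_smul c a)

variable (J hJ) in
/-- The quotient map, as a ⋆-homomorphism. -/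
noncomputable def mkHom : A →⋆ₙₐ[ℂ] J.CStarQuotient hJ where
  toFun := mk
  map_smul' _ _ := rfl
  map_zero' := rfl
  map_add' _ _ := rfl
  map_mul' _ _ := rfl
  map_star' _ := rfl

lemma mkHom_surjective : Function.Surjective (mkHom J hJ) :=
  Submodule.Quotient.mk_surjective _

lemma mkHom_eq_zero_iff {a : A} : mkHom J hJ a = 0 ↔ a ∈ J :=
  Submodule.Quotient.mk_eq_zero _

end CStarQuotient

end Quotient

section Orthogonal

lemma mul_eq_zero_of_inf_eq_bot {R : Type*} [NonUnitalNonAssocRing R] {K L : TwoSidedIdeal R}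
    (h : K ⊓ L = ⊥) {x y : R} (hx : x ∈ K) (hy : y ∈ L) : x * y = 0 := by
  rw [← mem_bot, ← h, mem_inf]
  exact ⟨K.mul_mem_right _ _ hx, L.mul_mem_left _ _ hy⟩

lemma inf_eq_bot_of_forall_mul_eq_zero {A : Type*} [NonUnitalCStarAlgebra A]
    {K L : TwoSidedIdeal A} (hL : IsClosed (L : Set A))
    (h : ∀ x ∈ K, ∀ y ∈ L, x * y = 0) : K ⊓ L = ⊥ := by
  refine eq_bot_iff.2 fun x hx ↦ ?_
  rw [mem_inf] at hx
  exact (mem_bot _).2 (CStarRing.mul_star_self_eq_zero_iff x |>.1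
    (h x hx.1 _ (star_mem_of_isClosed hL hx.2)))

end Orthogonal

section ClosedMap

variable {R S F : Type*} [NonUnitalNonAssocRing R] [NonUnitalNonAssocRing S] [TopologicalSpace S]
  [IsTopologicalRing S] [FunLike F R S] [NonUnitalRingHomClass F R S]

/-- The closure of the image of a two-sided ideal under a surjective ring homomorphism. -/
def closedMap (f : F) (hf : Function.Surjective f) (K : TwoSidedIdeal R) : TwoSidedIdeal S :=
  .mk' (closure (f '' K)) (subset_closure ⟨0, K.zero_mem, map_zero f⟩)
    (fun hx hy ↦ map_mem_closure₂ continuous_add hx hy (by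
      rintro _ ⟨a, ha, rfl⟩ _ ⟨b, hb, rfl⟩
      exact ⟨a + b, K.add_mem ha hb, map_add f a b⟩))
    (fun hx ↦ map_mem_closure continuous_neg hx (by
      rintro _ ⟨a, ha, rfl⟩
      exact ⟨-a, K.neg_mem ha, map_neg f a⟩))
    (fun {x _} hy ↦ map_mem_closure (continuous_const_mul x) hy (by
      obtain ⟨b, rfl⟩ := hf x
      rintro _ ⟨a, ha, rfl⟩
      exact ⟨b * a, K.mul_mem_left _ _ ha, map_mul f b a⟩))
    (fun {_ y} hx ↦ map_mem_closure (f := (· * y)) (continuous_mul_const y) hx (by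
      obtain ⟨b, rfl⟩ := hf y
      rintro _ ⟨a, ha, rfl⟩
      exact ⟨a * b, K.mul_mem_right _ _ ha, map_mul f a b⟩))

variable {f : F} {hf : Function.Surjective f} {K L : TwoSidedIdeal R}

lemma coe_closedMap : (closedMap f hf K : Set S) = closure (f '' K) :=
  coe_mk' _ _ _ _ _ _

lemma isClosed_closedMap : IsClosed (closedMap f hf K : Set S) :=
  coe_closedMap (hf := hf) ▸ isClosed_closure

lemma apply_mem_closedMap {x : R} (hx : x ∈ K) : f x ∈ closedMap f hf K := by
  rw [← SetLike.mem_coe, coe_closedMap]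
  exact subset_closure ⟨x, hx, rfl⟩

lemma mul_eq_zero_of_mem_closedMap [T1Space S] (h : K ⊓ L = ⊥) {x y : S}
    (hx : x ∈ closedMap f hf K) (hy : y ∈ closedMap f hf L) : x * y = 0 := by
  rw [← SetLike.mem_coe, coe_closedMap] at hx hy
  rw [← Set.mem_singleton_iff, ← (isClosed_singleton (x := (0 : S))).closure_eq]
  refine map_mem_closure₂ continuous_mul hx hy ?_
  rintro _ ⟨a, ha, rfl⟩ _ ⟨b, hb, rfl⟩
  rw [← map_mul, mul_eq_zero_of_inf_eq_bot h ha hb, map_zero]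
  rfl

end ClosedMap

end TwoSidedIdeal

lemma CStarCCC.countable_of_map {A B : Type*} [NonUnitalNonAssocRing A] [NonUnitalNonAssocRing B]
    [TopologicalSpace B] (hB : CStarCCC B) {𝒮 : Set (TwoSidedIdeal A)}
    (F : TwoSidedIdeal A → TwoSidedIdeal B) (hclosed : ∀ J ∈ 𝒮, IsClosed (F J : Set B))
    (hne : ∀ J ∈ 𝒮, F J ≠ ⊥) (horth : 𝒮.Pairwise fun J K ↦ F J ⊓ F K = ⊥) : 𝒮.Countable := by
  have hinj : 𝒮.InjOn F := fun J hJ K hK hJK ↦ by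
    by_contra hne'
    have : F J ⊓ F K = ⊥ := horth hJ hK hne'
    rw [← hJK, inf_idem] at this
    exact hne J hJ this
  refine Set.countable_of_injective_of_countable_image hinj (hB _ ?_ ?_ ?_)
  · rintro _ ⟨J, hJ, rfl⟩
    exact hclosed J hJ
  · rintro _ ⟨J, hJ, rfl⟩
    exact hne J hJ
  · rintro _ ⟨J, hJ, rfl⟩ _ ⟨K, hK, rfl⟩ hJK
    exact horth hJ hK fun h ↦ hJK (h ▸ rfl)

/-- If a closed two-sided ideal `I` of a C*-algebra `A` has the countable chain condition
(as a C*-algebra) and the quotient C*-algebra `A/I` (encoded here as any C*-algebra `B`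
together with a surjective *-homomorphism `A → B` whose kernel is `I`) has the countable
chain condition, then `A` has the countable chain condition. -/
theorem stmt_5 {A : Type u} [NonUnitalCStarAlgebra A] (I : TwoSidedIdeal A)
    (hI : IsClosed (I : Set A)) (hICCC : CStarCCC I)
    (hquot : ∀ (B : Type u) [NonUnitalCStarAlgebra B] (π : A →⋆ₙₐ[ℂ] B),
      Function.Surjective π → (∀ a : A, π a = 0 ↔ a ∈ I) → CStarCCC B) :
    CStarCCC A := by
  intro 𝒮 hclosed hne horth
  have hsplit : 𝒮 = {J ∈ 𝒮 | J ⊓ I ≠ ⊥} ∪ {J ∈ 𝒮 | J ⊓ I = ⊥} := by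
    ext J
    by_cases h : J ⊓ I = ⊥ <;> simp [h]
  rw [hsplit]
  refine .union ?_ ?_
  · let ι := NonUnitalSubringClass.subtype I
    refine hICCC.countable_of_map (TwoSidedIdeal.comap ι) ?_ ?_ ?_
    · intro J hJ
      have : (TwoSidedIdeal.comap ι J : Set I) = Subtype.val ⁻¹' (J : Set A) :=
        Set.ext fun x ↦ TwoSidedIdeal.mem_comap ι
      rw [this]
      exact (hclosed J hJ.1).preimage continuous_subtype_val
    · intro J hJ h
      refine hJ.2 (eq_bot_iff.2 fun x hx ↦ ?_)
      rw [TwoSidedIdeal.mem_inf] at hx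
      have hx' : (⟨x, hx.2⟩ : I) ∈ TwoSidedIdeal.comap ι J := (TwoSidedIdeal.mem_comap ι).2 hx.1
      rw [h, TwoSidedIdeal.mem_bot] at hx'
      exact (TwoSidedIdeal.mem_bot _).2 (congr_arg Subtype.val hx')
    · intro J hJ K hK hJK
      refine eq_bot_iff.2 fun x hx ↦ ?_
      rw [TwoSidedIdeal.mem_inf, TwoSidedIdeal.mem_comap, TwoSidedIdeal.mem_comap,
        ← TwoSidedIdeal.mem_inf, horth hJ.1 hK.1 hJK, TwoSidedIdeal.mem_bot] at hx
      exact (TwoSidedIdeal.mem_bot _).2 (Subtype.ext hx)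
  · have hsurj := TwoSidedIdeal.CStarQuotient.mkHom_surjective (J := I) (hJ := hI)
    refine (hquot _ _ hsurj fun _ ↦ TwoSidedIdeal.CStarQuotient.mkHom_eq_zero_iff).countable_of_map
      (TwoSidedIdeal.closedMap _ hsurj) (fun _ _ ↦ TwoSidedIdeal.isClosed_closedMap) ?_ ?_
    · intro J hJ h
      refine hne J hJ.1 (eq_bot_iff.2 fun x hx ↦ ?_)
      rw [← hJ.2, TwoSidedIdeal.mem_inf]
      refine ⟨hx, TwoSidedIdeal.CStarQuotient.mkHom_eq_zero_iff (hJ := hI).1 ?_⟩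
      rw [← TwoSidedIdeal.mem_bot, ← h]
      exact TwoSidedIdeal.apply_mem_closedMap hx
    · intro J hJ K hK hJK
      exact TwoSidedIdeal.inf_eq_bot_of_forall_mul_eq_zero TwoSidedIdeal.isClosed_closedMap
        fun x hx y hy ↦ TwoSidedIdeal.mul_eq_zero_of_mem_closedMap (horth hJ.1 hK.1 hJK) hx hy
end

section
/- Let A be a C*-algebra and I a closed two-sided ideal of A. If both I (as a C*-algebra) and the quotient C*-algebra A/I have the strong countable chain condition, then A has the strong countable chain condition. -/
/-- A C*-subalgebra (i.e. a closed *-subalgebra) `B` of a C*-algebra `A` is hereditary if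
whenever `a ∈ A` and `b ∈ B` are positive elements with `a ≤ b`, then `a ∈ B`. -/
def IsHereditarySubalgebra {A : Type*} [NonUnitalRing A] [Module ℂ A] [Star A]
    [TopologicalSpace A] [PartialOrder A] (B : NonUnitalStarSubalgebra ℂ A) : Prop :=
  IsClosed (B : Set A) ∧ ∀ a b : A, 0 ≤ a → 0 ≤ b → b ∈ B → a ≤ b → a ∈ B

/-- A C*-algebra has the strong countable chain condition (strong CCC) if every family of
pairwise orthogonal nonzero hereditary C*-subalgebras is countable; two hereditary
C*-subalgebras `B₁, B₂` are orthogonal if `b₁ * b₂ = 0` for all `b₁ ∈ B₁`, `b₂ ∈ B₂`. -/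
def StrongCCC (A : Type*) [NonUnitalRing A] [Module ℂ A] [Star A]
    [TopologicalSpace A] [PartialOrder A] : Prop :=
  ∀ 𝒮 : Set (NonUnitalStarSubalgebra ℂ A),
    (∀ B ∈ 𝒮, IsHereditarySubalgebra B ∧ ∃ b : A, b ∈ B ∧ b ≠ 0) →
    (𝒮.Pairwise fun B C => ∀ b ∈ B, ∀ c ∈ C, (b : A) * c = 0) → 𝒮.Countable

section Quotient

open Filter Topology in
lemma exists_norm_sub_mul_star_mul_self_lt {A : Type*} [NonUnitalCStarAlgebra A] (y : A) {ε : ℝ}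
    (hε : 0 < ε) : ∃ v : A, ‖star v * v‖ ≤ 1 ∧ ‖y - y * (star v * v)‖ < ε := by
  let : PartialOrder A := CStarAlgebra.spectralOrder A
  have : StarOrderedRing A := CStarAlgebra.spectralOrderedRing A
  have hl := CStarAlgebra.increasingApproximateUnit A
  have : (CStarAlgebra.approximateUnit A).NeBot := hl.neBot
  have hy := (Metric.tendsto_nhds.mp (hl.tendsto_mul_left y)) ε hε
  obtain ⟨u, hu₀, hu₁, hu⟩ := (hl.eventually_nonneg.and (hl.eventually_norm.and hy)).exists
  obtain ⟨v, rfl⟩ := CStarAlgebra.nonneg_iff_eq_star_mul_self.mp hu₀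
  exact ⟨v, hu₁, by rwa [← dist_eq_norm, dist_comm]⟩

open Unitization in
lemma norm_one_sub_inr_star_mul_self_le {A : Type*} [NonUnitalCStarAlgebra A] {v : A}
    (hv : ‖star v * v‖ ≤ 1) : ‖(1 : Unitization ℂ A) - (↑(star v * v) : Unitization ℂ A)‖ ≤ 1 := by
  let : PartialOrder A := CStarAlgebra.spectralOrder A
  have : StarOrderedRing A := CStarAlgebra.spectralOrderedRing A
  let : PartialOrder (Unitization ℂ A) := CStarAlgebra.spectralOrder _
  have : StarOrderedRing (Unitization ℂ A) := CStarAlgebra.spectralOrderedRing _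
  rw [← norm_inr (𝕜 := ℂ)] at hv
  have h₀ : 0 ≤ (↑(star v * v) : Unitization ℂ A) := by
    rw [inr_mul, inr_star]; exact star_mul_self_nonneg _
  have h₁ := CStarAlgebra.mem_Icc_iff_norm_le_one.mpr ⟨h₀, hv⟩
  exact (CStarAlgebra.mem_Icc_iff_norm_le_one.mp (Set.sub_mem_Icc_zero_iff_right.mpr h₁)).2

variable {A : Type*} [NonUnitalCStarAlgebra A]

open Unitization in
lemma norm_sub_mul_sq_le (a y v : A) (hv : ‖star v * v‖ ≤ 1) :
    ‖a - a * (star v * v)‖ ^ 2 ≤ ‖star a * a + y‖ + ‖y - y * (star v * v)‖ := by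
  have hw := norm_one_sub_inr_star_mul_self_le hv
  have hsa : star (star v * v) = star v * v := by simp
  set u := star v * v
  set w : Unitization ℂ A := 1 - (u : Unitization ℂ A) with hwdef
  have hws : star w = w := by simp [hwdef, ← inr_star, hsa]
  have e₁ : ((a - a * u : A) : Unitization ℂ A) = a * w := by simp [hwdef, mul_sub]
  have e₂ : ((y - y * u : A) : Unitization ℂ A) = y * w := by simp [hwdef, mul_sub]
  rw [← norm_inr (𝕜 := ℂ), ← norm_inr (𝕜 := ℂ) (a := y - y * u),
    ← norm_inr (𝕜 := ℂ) (a := star a * a + y), e₁, e₂, sq, ← CStarRing.norm_star_mul_self]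
  have e₃ : star ((a : Unitization ℂ A) * w) * (a * w) =
      w * ↑(star a * a + y) * w - w * (y * w) := by
    simp [hws]; noncomm_ring
  rw [e₃]
  refine (norm_sub_le _ _).trans (add_le_add ?_ ?_)
  · refine (norm_mul_le _ _).trans ((mul_le_of_le_one_right (norm_nonneg _) hw).trans ?_)
    exact (norm_mul_le _ _).trans (mul_le_of_le_one_left (norm_nonneg _) hw)
  · exact (norm_mul_le _ _).trans (mul_le_of_le_one_left (norm_nonneg _) hw)

variable (I : NonUnitalStarSubalgebra ℂ A)

/-- The quotient of a C*-algebra by (the submodule underlying) a star subalgebra. -/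
abbrev CStarQuotient : Type _ := A ⧸ I.toNonUnitalSubalgebra.toSubmodule

variable {I}

namespace CStarQuotient

/-- The quotient map. -/
abbrev mk (a : A) : CStarQuotient I := Submodule.Quotient.mk a

lemma mk_eq_mk {a b : A} : (mk a : CStarQuotient I) = mk b ↔ a - b ∈ I :=
  Submodule.Quotient.eq _

/-- Multiplication on the quotient by an ideal. -/
abbrev mulOfIdeal (hideal : ∀ a x : A, x ∈ I → a * x ∈ I ∧ x * a ∈ I) : Mul (CStarQuotient I) where
  mul p q := Quotient.liftOn₂' p q (fun a b ↦ mk (a * b)) fun a b c d hac hbd ↦ by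
    have hac : a - c ∈ I := mk_eq_mk.mp (Quotient.sound' hac)
    have hbd : b - d ∈ I := mk_eq_mk.mp (Quotient.sound' hbd)
    rw [mk_eq_mk]
    have : a * b - c * d = (a - c) * b + c * (b - d) := by noncomm_ring
    rw [this]
    exact add_mem (hideal _ _ hac).2 (hideal _ _ hbd).1

/-- The star operation on the quotient. -/
abbrev instStarQuotient : Star (CStarQuotient I) where
  star p := Quotient.liftOn' p (fun a ↦ mk (star a)) fun a c hac ↦ by
    have hac : a - c ∈ I := mk_eq_mk.mp (Quotient.sound' hac)
    rw [mk_eq_mk, ← star_sub]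
    exact star_mem hac

lemma norm_mk_sq_le [hI : IsClosed (I : Set A)]
    (hideal : ∀ a x : A, x ∈ I → a * x ∈ I ∧ x * a ∈ I) (a : A) :
    ‖(mk a : CStarQuotient I)‖ * ‖(mk a : CStarQuotient I)‖ ≤
      ‖(mk (star a * a) : CStarQuotient I)‖ := by
  refine le_of_forall_pos_le_add fun ε hε ↦ ?_
  obtain ⟨b, hb, hbn⟩ :=
    Submodule.Quotient.norm_mk_lt (mk (star a * a) : CStarQuotient I) (half_pos hε)
  have hy : b - star a * a ∈ I := mk_eq_mk.mp hb
  obtain ⟨v, hv, hyv⟩ := exists_norm_sub_mul_star_mul_self_lt (⟨_, hy⟩ : I) (half_pos hε)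
  have hle : ‖(mk a : CStarQuotient I)‖ ≤ ‖a - a * (star (v : A) * v)‖ := by
    have : (mk a : CStarQuotient I) = mk (a - a * (star (v : A) * v)) := by
      rw [mk_eq_mk, sub_sub_cancel, ← mul_assoc]
      exact (hideal _ _ v.2).1
    rw [this]
    exact Submodule.Quotient.norm_mk_le _ _
  have := norm_sub_mul_sq_le a (b - star a * a) (v : A) hv
  rw [add_sub_cancel] at this
  have h' : ‖(b - star a * a) - (b - star a * a) * (star (v : A) * v)‖ < ε / 2 := hyv
  nlinarith [norm_nonneg (mk a : CStarQuotient I)]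

/-- The quotient of a C*-algebra by a closed two-sided ideal is a C*-algebra. -/
noncomputable abbrev nonUnitalCStarAlgebra [hI : IsClosed (I : Set A)]
    (hideal : ∀ a x : A, x ∈ I → a * x ∈ I ∧ x * a ∈ I) :
    NonUnitalCStarAlgebra (CStarQuotient I) :=
  haveI : IsClosed (I.toNonUnitalSubalgebra.toSubmodule : Set A) := hI
  letI := mulOfIdeal hideal
  letI := instStarQuotient (I := I)
  { Submodule.Quotient.normedAddCommGroup I.toNonUnitalSubalgebra.toSubmodule,
    Submodule.Quotient.normedSpace I.toNonUnitalSubalgebra.toSubmodule ℂ,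
    Submodule.Quotient.completeSpace I.toNonUnitalSubalgebra.toSubmodule,
    mulOfIdeal hideal, instStarQuotient (I := I) with
    left_distrib := by
      rintro ⟨a⟩ ⟨b⟩ ⟨c⟩; exact congrArg mk (mul_add a b c)
    right_distrib := by
      rintro ⟨a⟩ ⟨b⟩ ⟨c⟩; exact congrArg mk (add_mul a b c)
    zero_mul := by rintro ⟨a⟩; exact congrArg mk (zero_mul a)
    mul_zero := by rintro ⟨a⟩; exact congrArg mk (mul_zero a)
    mul_assoc := by rintro ⟨a⟩ ⟨b⟩ ⟨c⟩; exact congrArg mk (mul_assoc a b c)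
    star_involutive := by rintro ⟨a⟩; exact congrArg mk (star_star a)
    star_mul := by rintro ⟨a⟩ ⟨b⟩; exact congrArg mk (star_mul a b)
    star_add := by rintro ⟨a⟩ ⟨b⟩; exact congrArg mk (star_add a b)
    star_smul := by rintro r ⟨a⟩; exact congrArg mk (star_smul r a)
    smul_assoc := by rintro r ⟨a⟩ ⟨b⟩; exact congrArg mk (smul_mul_assoc r a b)
    smul_comm := by rintro r ⟨a⟩ ⟨b⟩; exact congrArg mk (mul_smul_comm r a b).symm
    norm_mul_le := by
      intro p q
      have key : ∀ ε > 0, ‖p * q‖ ≤ (‖p‖ + ε) * (‖q‖ + ε) := by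
        intro ε hε
        obtain ⟨a, rfl, ha⟩ := Submodule.Quotient.norm_mk_lt p hε
        obtain ⟨b, rfl, hb⟩ := Submodule.Quotient.norm_mk_lt q hε
        calc _ ≤ ‖a * b‖ := Submodule.Quotient.norm_mk_le _ (a * b)
          _ ≤ ‖a‖ * ‖b‖ := norm_mul_le a b
          _ ≤ _ := by gcongr
      have hc : Filter.Tendsto (fun ε : ℝ ↦ (‖p‖ + ε) * (‖q‖ + ε)) (nhdsWithin 0 (Set.Ioi 0))
          (nhds ((‖p‖ + 0) * (‖q‖ + 0))) :=
        (Continuous.tendsto (by fun_prop) 0).mono_left nhdsWithin_le_nhds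
      simp only [add_zero] at hc
      exact ge_of_tendsto hc (by filter_upwards [self_mem_nhdsWithin] with ε hε using key ε hε)
    norm_mul_self_le := by rintro ⟨a⟩; exact norm_mk_sq_le hideal a }

end CStarQuotient

end Quotient

section Annihilator

variable {D : Type*} [NonUnitalCStarAlgebra D]

/-- The star subalgebra of all `x` such that both `x` and `star x` annihilate `T` from the left. -/
def starAnnihilator (T : Set D) : NonUnitalStarSubalgebra ℂ D where
  carrier := {x | ∀ t ∈ T, x * t = 0 ∧ star x * t = 0}
  add_mem' hx hy t ht := by simp [add_mul, hx t ht, hy t ht]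
  zero_mem' t _ := by simp
  mul_mem' hx hy t ht := by
    rw [mul_assoc, (hy t ht).1, star_mul, mul_assoc, (hx t ht).2]; simp
  smul_mem' c x hx t ht := by simp [smul_mul_assoc, hx t ht]
  star_mem' hx t ht := by simp [hx t ht]

lemma mem_starAnnihilator {T : Set D} {x : D} :
    x ∈ starAnnihilator T ↔ ∀ t ∈ T, x * t = 0 ∧ star x * t = 0 := Iff.rfl

lemma mul_eq_zero_of_star_mul_mul_eq_zero [PartialOrder D] [StarOrderedRing D] {a t : D}
    (ha : 0 ≤ a) (h : star t * a * t = 0) : a * t = 0 := by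
  obtain ⟨c, rfl⟩ := CStarAlgebra.nonneg_iff_eq_star_mul_self.mp ha
  have hc : c * t = 0 := by
    rw [← CStarRing.star_mul_self_eq_zero_iff, star_mul, ← h]
    simp only [mul_assoc]
  rw [mul_assoc, hc, mul_zero]

lemma isHereditarySubalgebra_starAnnihilator [PartialOrder D] [StarOrderedRing D] (T : Set D) :
    IsHereditarySubalgebra (starAnnihilator T) := by
  refine ⟨?_, fun a b ha _ hbT hab t ht ↦ ?_⟩
  · have : (starAnnihilator T : Set D) = ⋂ t ∈ T, {x | x * t = 0 ∧ star x * t = 0} := by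
      ext x; simp [mem_starAnnihilator]
    rw [this]
    exact isClosed_biInter fun t _ ↦ (isClosed_eq (by fun_prop) continuous_const).inter
      (isClosed_eq (by fun_prop) continuous_const)
  · have h : a * t = 0 := by
      refine mul_eq_zero_of_star_mul_mul_eq_zero ha (le_antisymm ?_ ?_)
      · refine (star_left_conjugate_le_conjugate hab t).trans_eq ?_
        rw [mul_assoc, (hbT t ht).1, mul_zero]
      · exact star_left_conjugate_nonneg ha t
    exact ⟨h, by rwa [ha.isSelfAdjoint.star_eq]⟩

lemma mem_starAnnihilator_starAnnihilator {S : Set D} {s : D} (hs : s ∈ S) (hs' : star s ∈ S) :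
    s ∈ starAnnihilator (starAnnihilator S : Set D) := by
  intro x hx
  constructor
  · simpa using congrArg star (hx _ hs').2
  · simpa using congrArg star (hx _ hs).2

lemma mul_eq_zero_of_mem_starAnnihilator_starAnnihilator {S T : Set D}
    (hS : ∀ s ∈ S, star s ∈ S) (h : ∀ s ∈ S, ∀ t ∈ T, s * t = 0) {x y : D}
    (hx : x ∈ starAnnihilator (starAnnihilator S : Set D))
    (hy : y ∈ starAnnihilator (starAnnihilator T : Set D)) : x * y = 0 :=
  (hx y fun s hs ↦ hy s fun t ht ↦ ⟨h s hs t ht, h _ (hS s hs) t ht⟩).1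

lemma StrongCCC.countable_of_pairwise_orthogonal [PartialOrder D] (hD : StrongCCC D) {ι : Type*}
    {s : Set ι} (F : ι → NonUnitalStarSubalgebra ℂ D)
    (hF : ∀ i ∈ s, IsHereditarySubalgebra (F i) ∧ ∃ b : D, b ∈ F i ∧ b ≠ 0)
    (horth : s.Pairwise fun i j ↦ ∀ b ∈ F i, ∀ c ∈ F j, b * c = 0) : s.Countable := by
  have hinj : Set.InjOn F s := by
    intro i hi j hj hij
    by_contra hne
    obtain ⟨b, hb, hb0⟩ := (hF i hi).2
    exact hb0 ((CStarRing.star_mul_self_eq_zero_iff b).mp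
      (horth hi hj hne _ (star_mem hb) b (hij ▸ hb)))
  refine Set.countable_of_injective_of_countable_image hinj (hD (F '' s) ?_ ?_)
  · rintro _ ⟨i, hi, rfl⟩
    exact hF i hi
  · rintro _ ⟨i, hi, rfl⟩ _ ⟨j, hj, rfl⟩ hne
    exact horth hi hj fun h ↦ hne (h ▸ rfl)

end Annihilator

lemma IsHereditarySubalgebra.comap_subtype {A : Type*} [NonUnitalCStarAlgebra A] [PartialOrder A]
    (I : NonUnitalStarSubalgebra ℂ A) {B : NonUnitalStarSubalgebra ℂ A}
    (hB : IsHereditarySubalgebra B) :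
    IsHereditarySubalgebra (B.comap (NonUnitalStarSubalgebraClass.subtype I)) :=
  ⟨hB.1.preimage continuous_subtype_val, fun a b ha hb hbB hab ↦ hB.2 a b ha hb hbB hab⟩

/-- If a closed two-sided ideal `I` of a C*-algebra `A` (recall that a closed two-sided
ideal of a C*-algebra is automatically a closed *-subalgebra, so we encode it as a closed
*-subalgebra which absorbs multiplication on both sides) has the strong countable chain
condition, and the quotient C*-algebra `A/I` (encoded as any C*-algebra `B` together with
a surjective *-homomorphism `A → B` whose kernel is `I`) has the strong countable chain
condition, then `A` has the strong countable chain condition. -/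
theorem stmt_18 {A : Type u} [NonUnitalCStarAlgebra A] [PartialOrder A]
    [StarOrderedRing A] (I : NonUnitalStarSubalgebra ℂ A)
    (hI : IsClosed (I : Set A))
    (hideal : ∀ a x : A, x ∈ I → a * x ∈ I ∧ x * a ∈ I)
    (hIstrong : StrongCCC I)
    (hquot : ∀ (B : Type u) [NonUnitalCStarAlgebra B] [PartialOrder B]
      [StarOrderedRing B] (π : A →⋆ₙₐ[ℂ] B),
      Function.Surjective π → (∀ a : A, π a = 0 ↔ a ∈ I) → StrongCCC B) :
    StrongCCC A := by
  intro 𝒮 h𝒮 horth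
  let _ : NonUnitalCStarAlgebra (CStarQuotient I) := CStarQuotient.nonUnitalCStarAlgebra hideal
  let _ : PartialOrder (CStarQuotient I) := CStarAlgebra.spectralOrder _
  have _ : StarOrderedRing (CStarQuotient I) := CStarAlgebra.spectralOrderedRing _
  let π : A →⋆ₙₐ[ℂ] CStarQuotient I :=
    { toFun := CStarQuotient.mk
      map_smul' := fun _ _ ↦ rfl
      map_zero' := rfl
      map_add' := fun _ _ ↦ rfl
      map_mul' := fun _ _ ↦ rfl
      map_star' := fun _ ↦ rfl }
  have hker (a : A) : π a = 0 ↔ a ∈ I := Submodule.Quotient.mk_eq_zero _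
  have hQ := hquot (CStarQuotient I) π (Submodule.Quotient.mk_surjective _) hker
  have hin : {B ∈ 𝒮 | B ≤ I}.Countable := by
    refine hIstrong.countable_of_pairwise_orthogonal
      (fun B ↦ B.comap (NonUnitalStarSubalgebraClass.subtype I)) ?_ ?_
    · rintro B ⟨hB, hBI⟩
      obtain ⟨b, hb, hb0⟩ := (h𝒮 B hB).2
      exact ⟨(h𝒮 B hB).1.comap_subtype I, ⟨b, hBI hb⟩, hb, fun h ↦ hb0 (congrArg Subtype.val h)⟩
    · rintro B ⟨hB, -⟩ C ⟨hC, -⟩ hne b hb c hc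
      exact Subtype.ext (horth hB hC hne b hb c hc)
  have hout : {B ∈ 𝒮 | ¬ B ≤ I}.Countable := by
    have hstar (B : NonUnitalStarSubalgebra ℂ A) : ∀ s ∈ π '' B, star s ∈ π '' B := by
      rintro _ ⟨b, hb, rfl⟩
      exact ⟨star b, star_mem hb, map_star π b⟩
    refine hQ.countable_of_pairwise_orthogonal
      (fun B ↦ starAnnihilator (starAnnihilator (π '' B) : Set (CStarQuotient I))) ?_ ?_
    · rintro B ⟨-, hBI⟩
      obtain ⟨b, hb, hbI⟩ := SetLike.not_le_iff_exists.mp hBI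
      have hπb : π b ∈ π '' B := ⟨b, hb, rfl⟩
      exact ⟨isHereditarySubalgebra_starAnnihilator _, π b,
        mem_starAnnihilator_starAnnihilator hπb (hstar B _ hπb), fun h ↦ hbI ((hker b).mp h)⟩
    · rintro B ⟨hB, -⟩ C ⟨hC, -⟩ hne x hx y hy
      refine mul_eq_zero_of_mem_starAnnihilator_starAnnihilator (hstar B) ?_ hx hy
      rintro _ ⟨b, hb, rfl⟩ _ ⟨c, hc, rfl⟩
      rw [← map_mul, horth hB hC hne b hb c hc, map_zero]
  refine (hin.union hout).mono fun B hB ↦ ?_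
  by_cases h : B ≤ I
  · exact Or.inl ⟨hB, h⟩
  · exact Or.inr ⟨hB, h⟩
end

section
/- A von Neumann algebra M (a unital *-subalgebra of the bounded operators on a complex Hilbert space equal to its double commutant) has the strong countable chain condition if and only if M is σ-finite, i.e., M admits no uncountable family of pairwise orthogonal nonzero projections. -/
/-- The corner `p A p` of a *-algebra `A` at a self-adjoint element `p`, described as the set of
elements fixed by multiplication with `p` on either side. -/
def selfAdjointCorner {A : Type*} [Ring A] [StarRing A] [Algebra ℂ A] [StarModule ℂ A] (p : A)
    (hp : IsSelfAdjoint p) : NonUnitalStarSubalgebra ℂ A where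
  carrier := {a | p * a = a ∧ a * p = a}
  add_mem' := fun ⟨ha, ha'⟩ ⟨hb, hb'⟩ => ⟨by rw [mul_add, ha, hb], by rw [add_mul, ha', hb']⟩
  zero_mem' := ⟨mul_zero p, zero_mul p⟩
  mul_mem' := fun ⟨ha, _⟩ ⟨_, hb'⟩ => ⟨by rw [← mul_assoc, ha], by rw [mul_assoc, hb']⟩
  smul_mem' := fun c _ ⟨ha, ha'⟩ => ⟨by rw [mul_smul_comm, ha], by rw [smul_mul_assoc, ha']⟩
  star_mem' := fun {a} ⟨ha, ha'⟩ => by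
    refine ⟨?_, ?_⟩
    · simpa [hp.star_eq] using congrArg star ha'
    · simpa [hp.star_eq] using congrArg star ha

theorem mul_eq_zero_of_le_of_mul_eq_zero {A : Type*} [CStarAlgebra A] [PartialOrder A]
    [StarOrderedRing A] {a b c : A} (ha : 0 ≤ a) (hab : a ≤ b) (hbc : b * c = 0) :
    a * c = 0 := by
  have hle : star c * a * c ≤ 0 := by
    simpa [mul_assoc, hbc] using star_left_conjugate_le_conjugate hab c
  have hge : 0 ≤ star c * a * c := star_left_conjugate_nonneg ha c
  have hs : CFC.sqrt a * CFC.sqrt a = a := CFC.sqrt_mul_sqrt_self a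
  have hsa : star (CFC.sqrt a) = CFC.sqrt a := (CFC.sqrt_nonneg a).isSelfAdjoint.star_eq
  have h0 : star (CFC.sqrt a * c) * (CFC.sqrt a * c) = 0 := by
    rw [star_mul, hsa, mul_assoc, ← mul_assoc (CFC.sqrt a), hs, ← mul_assoc]
    exact le_antisymm hle hge
  rw [← hs, mul_assoc, (CStarRing.star_mul_self_eq_zero_iff _).mp h0, mul_zero]

namespace VonNeumannAlgebra

variable {H : Type*} [NormedAddCommGroup H] [InnerProductSpace ℂ H] [CompleteSpace H]

theorem isHereditarySubalgebra_selfAdjointCorner (M : VonNeumannAlgebra H)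
    (p : M.toStarSubalgebra) (hp : IsSelfAdjoint p) :
    IsHereditarySubalgebra (selfAdjointCorner p hp) := by
  refine ⟨?_, fun a b ha hb hbp hab => ?_⟩
  · exact (isClosed_eq (continuous_const.mul continuous_id) continuous_id).inter
      (isClosed_eq (continuous_id.mul continuous_const) continuous_id)
  · have hap : a * (1 - p) = 0 := by
      have hbp' : b * (1 - p) = 0 := by rw [mul_sub, mul_one, hbp.2, sub_self]
      exact Subtype.ext (mul_eq_zero_of_le_of_mul_eq_zero (A := H →L[ℂ] H) ha hab
        (congrArg Subtype.val hbp'))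
    have hap' : a * p = a := by
      rw [mul_sub, mul_one, sub_eq_zero] at hap
      exact hap.symm
    have hsa : IsSelfAdjoint a :=
      Subtype.ext (IsSelfAdjoint.of_nonneg (R := H →L[ℂ] H) ha).star_eq
    exact ⟨by simpa [hp.star_eq, hsa.star_eq] using congrArg star hap', hap'⟩

/-- The projection onto the closure of the range of an operator. -/
noncomputable def rangeProjection (b : H →L[ℂ] H) : H →L[ℂ] H :=
  b.range.topologicalClosure.starProjection

theorem isStarProjection_rangeProjection (b : H →L[ℂ] H) :
    IsStarProjection (rangeProjection b) :=
  isStarProjection_starProjection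

theorem rangeProjection_mem (M : VonNeumannAlgebra H) {b : H →L[ℂ] H} (hb : b ∈ M) :
    rangeProjection b ∈ M := by
  rw [IsStarProjection.mem_iff (isStarProjection_rangeProjection b)]
  intro y hy
  have hyb : b * y = y * b := mem_commutant_iff.mp hy b hb
  rw [rangeProjection, Submodule.range_starProjection,
    Module.End.mem_invtSubmodule_iff_forall_mem_of_mem]
  intro x hx
  have hmaps : Set.MapsTo y (b.range : Set H) (b.range : Set H) := by
    rintro _ ⟨z, rfl⟩
    exact ⟨y z, congrArg (fun T : H →L[ℂ] H => T z) hyb⟩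
  exact hmaps.closure y.continuous hx

theorem rangeProjection_mul_eq_zero {b c : H →L[ℂ] H} (h : star b * c = 0) :
    rangeProjection b * rangeProjection c = 0 := by
  refine Submodule.IsOrtho.starProjection_comp_starProjection ?_
  rw [Submodule.isOrtho_iff_le, Submodule.orthogonal_closure]
  refine Submodule.topologicalClosure_minimal _ ?_ (Submodule.isClosed_orthogonal _)
  rintro _ ⟨x, rfl⟩
  rw [Submodule.mem_orthogonal]
  rintro _ ⟨y, rfl⟩
  have hxy : star b (c y) = 0 := congrArg (fun T : H →L[ℂ] H => T y) h
  rw [ContinuousLinearMap.star_eq_adjoint] at hxy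
  change inner ℂ (c y) (b x) = 0
  rw [← ContinuousLinearMap.adjoint_inner_left, hxy, inner_zero_left]

theorem rangeProjection_ne_zero {b : H →L[ℂ] H} (hb : b ≠ 0) : rangeProjection b ≠ 0 := by
  intro h
  refine hb (ContinuousLinearMap.ext fun x => ?_)
  have hx : rangeProjection b (b x) = b x :=
    Submodule.starProjection_eq_self_iff.mpr (subset_closure ⟨x, rfl⟩)
  rw [← hx, h]
  rfl

end VonNeumannAlgebra

/-- A von Neumann algebra `M` (a unital *-subalgebra of bounded operators on a complex
Hilbert space equal to its double commutant) has the strong countable chain condition if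
and only if `M` is σ-finite, i.e. `M` admits no uncountable family of pairwise orthogonal
nonzero projections. -/
theorem stmt_19 {H : Type*} [NormedAddCommGroup H] [InnerProductSpace ℂ H]
    [CompleteSpace H] (M : VonNeumannAlgebra H) :
    StrongCCC M.toStarSubalgebra ↔
      ¬∃ P : Set M.toStarSubalgebra, ¬P.Countable ∧
        (∀ p ∈ P, p ≠ 0 ∧ IsSelfAdjoint p ∧ IsIdempotentElem p) ∧
        P.Pairwise fun p q => p * q = 0 := by
  constructor
  · rintro hM ⟨P, hPc, hP, hPo⟩
    refine hPc ?_
    let C : P → NonUnitalStarSubalgebra ℂ M.toStarSubalgebra :=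
      fun p => selfAdjointCorner p.1 (hP p.1 p.2).2.1
    have hmem (p : P) : p.1 ∈ C p := ⟨(hP p.1 p.2).2.2, (hP p.1 p.2).2.2⟩
    have horth (p q : P) (hpq : p ≠ q) : ∀ b ∈ C p, ∀ c ∈ C q, b * c = 0 := by
      rintro b ⟨-, hb⟩ c ⟨hc, -⟩
      rw [← hb, ← hc, mul_assoc, ← mul_assoc p.1, hPo p.2 q.2 (Subtype.coe_ne_coe.mpr hpq),
        zero_mul, mul_zero]
    have hinj : Function.Injective C := by
      intro p q hpq
      by_contra hne
      refine (hP p.1 p.2).1 ?_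
      rw [← (hP p.1 p.2).2.2.eq]
      exact horth p q hne _ (hmem p) _ (hpq ▸ hmem p)
    have hcount : (Set.range C).Countable := by
      refine hM _ ?_ ?_
      · rintro _ ⟨p, rfl⟩
        exact ⟨M.isHereditarySubalgebra_selfAdjointCorner _ _, p.1, hmem p, (hP p.1 p.2).1⟩
      · rintro _ ⟨p, rfl⟩ _ ⟨q, rfl⟩ hpq
        exact horth p q fun h => hpq (congrArg C h)
    have := Set.countable_coe_iff.mpr hcount
    exact Set.countable_coe_iff.mp (Set.rangeFactorization_injective.mpr hinj).countable
  · intro hM 𝒮 h𝒮 ho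
    by_contra hc
    choose! f hf hf0 using fun B hB => (h𝒮 B hB).2
    let e : NonUnitalStarSubalgebra ℂ M.toStarSubalgebra → M.toStarSubalgebra :=
      fun B => ⟨VonNeumannAlgebra.rangeProjection (f B : H →L[ℂ] H),
        M.rangeProjection_mem (f B).2⟩
    have hproj (B) : IsStarProjection (e B : H →L[ℂ] H) :=
      VonNeumannAlgebra.isStarProjection_rangeProjection _
    have hne (B) (hB : B ∈ 𝒮) : e B ≠ 0 := fun h =>
      VonNeumannAlgebra.rangeProjection_ne_zero (fun h' => hf0 B hB (Subtype.ext h'))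
        (congrArg Subtype.val h)
    have horth (B) (hB : B ∈ 𝒮) (C) (hC : C ∈ 𝒮) (hBC : B ≠ C) : e B * e C = 0 :=
      Subtype.ext (VonNeumannAlgebra.rangeProjection_mul_eq_zero
        (congrArg Subtype.val (ho hB hC hBC _ (star_mem (hf B hB)) _ (hf C hC))))
    have hidem (B) : IsIdempotentElem (e B) := Subtype.ext (hproj B).isIdempotentElem
    have hinj : Set.InjOn e 𝒮 := by
      intro B hB C hC hBC
      by_contra hBC'
      refine hne B hB ?_
      rw [← (hidem B).eq]
      nth_rewrite 2 [hBC]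
      exact horth B hB C hC hBC'
    refine hM ⟨e '' 𝒮, fun h => hc ((Set.mapsTo_image e 𝒮).countable_of_injOn hinj h), ?_, ?_⟩
    · rintro _ ⟨B, hB, rfl⟩
      exact ⟨hne B hB, Subtype.ext (hproj B).isSelfAdjoint.star_eq, hidem B⟩
    · rintro _ ⟨B, hB, rfl⟩ _ ⟨C, hC, rfl⟩ hBC
      exact horth B hB C hC fun h => hBC (congrArg e h)
end
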